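/- Let a, b > 0 satisfy the nine inequalities 2a + b ≥ 1, 3a + 4b ≥ 2, 9a + 11b ≥ 6, a + 5b ≥ 1, 4a + 9b ≥ 3, 10a + 16b ≥ 7, 13a + 20b ≥ 8, 5a + 14b ≥ 4, a + (3/2)b ≥ 2/3. Let G be a graph with no triangle adjacent to a 4-cycle such that α(G) < |V(G)| − (a|V(G)| + b|E(G)| + bλ(G)), and suppose every graph G' with fewer vertices than G and no triangle adjacent to a 4-cycle satisfies α(G') ≥ |V(G')| − (a|V(G')| + b|E(G')| + bλ(G')). Then every triangle H in G satisfies Φ(H) ≥ 3, where Φ(H) is the number of edges of G with exactly one endpoint in V(H). -/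

import Mathlib

namespace Paper

/-- `s` is an independent set in the simple graph `G`. -/
def IsIndepSet {V : Type} (G : SimpleGraph V) (s : Finset V) : Prop :=
  ∀ v ∈ s, ∀ w ∈ s, ¬ G.Adj v w

/-- The independence number `α(G)`: the size of a largest independent set. -/
noncomputable def indepNum {V : Type} (G : SimpleGraph V) : ℕ :=
  sSup {n | ∃ s : Finset V, IsIndepSet G s ∧ s.card = n}

/-- The number of edges `|E(G)|`. -/
noncomputable def numEdges {V : Type} (G : SimpleGraph V) : ℕ :=
  Nat.card G.edgeSet

/-- The degree of a vertex. -/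
noncomputable def deg {V : Type} (G : SimpleGraph V) (v : V) : ℕ :=
  Nat.card (G.neighborSet v)

/-- `G` contains a triangle sharing a common edge with a 4-cycle:
the triangle `u v w` and the 4-cycle `u v x y` share the edge `u v`. -/
def HasTriangleAdjC4 {V : Type} (G : SimpleGraph V) : Prop :=
  ∃ u v w x y : V, G.Adj u v ∧ G.Adj v w ∧ G.Adj w u ∧
    G.Adj v x ∧ G.Adj x y ∧ G.Adj y u ∧ u ≠ x ∧ v ≠ y

/-- `G` contains two triangles sharing a common edge:
the triangles `u v w` and `u v x` share the edge `u v`. -/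
def HasAdjTriangles {V : Type} (G : SimpleGraph V) : Prop :=
  ∃ u v w x : V, G.Adj u v ∧ G.Adj v w ∧ G.Adj w u ∧
    G.Adj v x ∧ G.Adj x u ∧ w ≠ x

/-- `G` contains a triangle sharing a common edge with a 5-cycle:
the triangle `u v w` and the 5-cycle `u v x y z` share the edge `u v`. -/
def HasTriangleAdjC5 {V : Type} (G : SimpleGraph V) : Prop :=
  ∃ u v w x y z : V, G.Adj u v ∧ G.Adj v w ∧ G.Adj w u ∧
    G.Adj v x ∧ G.Adj x y ∧ G.Adj y z ∧ G.Adj z u ∧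
    u ≠ x ∧ u ≠ y ∧ v ≠ y ∧ v ≠ z ∧ x ≠ z

/-- The 2-chain of triangles: two disjoint triangles `{0,1,2}` and `{3,4,5}`
joined by the single edge `{2,3}` (6 vertices, 7 edges). -/
def chainGraph : SimpleGraph (Fin 6) :=
  SimpleGraph.fromRel (fun i j =>
    (i.val, j.val) ∈ [(0,1), (0,2), (1,2), (3,4), (3,5), (4,5), (2,3)])

/-- A connected component is difficult if it is a triangle or a 2-chain of triangles. -/
def IsDifficult {V : Type} (G : SimpleGraph V) (c : G.ConnectedComponent) : Prop :=
  Nonempty (SimpleGraph.induce c.supp G ≃g (⊤ : SimpleGraph (Fin 3))) ∨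
  Nonempty (SimpleGraph.induce c.supp G ≃g chainGraph)

/-- `λ(G)`: the number of difficult components of `G`. -/
noncomputable def lambda {V : Type} (G : SimpleGraph V) : ℕ :=
  Nat.card {c : G.ConnectedComponent // IsDifficult G c}

/-- `Φ(S)`: the number of edges of `G` with exactly one endpoint in `S`. -/
noncomputable def phi {V : Type} (G : SimpleGraph V) (S : Set V) : ℕ :=
  Nat.card {e : Sym2 V | e ∈ G.edgeSet ∧ ∃ x ∈ S, ∃ y, y ∉ S ∧ e = s(x, y)}

open SimpleGraph

section Bound

/-- The lower bound on the independence number that a minimum counterexample violates. -/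
def HasBound (a b : ℝ) {V : Type} (G : SimpleGraph V) : Prop :=
  (indepNum G : ℝ) ≥ (Nat.card V : ℝ) - (a * Nat.card V + b * numEdges G + b * lambda G)

/-- `D` is the range of an induced copy of a triangle or of a 2-chain of triangles. -/
def IsDifficultSet {V : Type} (G : SimpleGraph V) (D : Set V) : Prop :=
  (∃ f : (⊤ : SimpleGraph (Fin 3)) ↪g G, Set.range f = D) ∨
    ∃ f : chainGraph ↪g G, Set.range f = D

/-- The vertex sets of the difficult components of the subgraph induced on `T`. -/
def difficultSets {V : Type} (G : SimpleGraph V) (T : Set V) : Set (Set V) :=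
  {D | IsDifficultSet G D ∧ D ⊆ T ∧ ∀ x ∈ D, ∀ y ∈ T, G.Adj x y → y ∈ D}

/-- The edges of `G` with exactly one endpoint in `S`. -/
def boundary {V : Type} (G : SimpleGraph V) (S : Set V) : Set (Sym2 V) :=
  {e : Sym2 V | e ∈ G.edgeSet ∧ ∃ x ∈ S, ∃ y, y ∉ S ∧ e = s(x, y)}

theorem mem_boundary {V : Type} {G : SimpleGraph V} {S : Set V} {x y : V} (h : G.Adj x y)
    (hx : x ∈ S) (hy : y ∉ S) : s(x, y) ∈ boundary G S :=
  ⟨h, x, hx, y, hy, rfl⟩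

end Bound

section IndependentSets

variable {V : Type} [Fintype V]

theorem IsIndepSet.card_le_indepNum {G : SimpleGraph V} {s : Finset V} (h : IsIndepSet G s) :
    s.card ≤ indepNum G := by
  refine le_csSup ⟨Fintype.card V, ?_⟩ ⟨s, h, rfl⟩
  rintro n ⟨t, -, rfl⟩
  exact Finset.card_le_univ t

theorem exists_isIndepSet_card_eq (G : SimpleGraph V) :
    ∃ s : Finset V, IsIndepSet G s ∧ s.card = indepNum G := by
  have hne : {n | ∃ s : Finset V, IsIndepSet G s ∧ s.card = n}.Nonempty :=
    ⟨0, ∅, by simp [IsIndepSet], rfl⟩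
  refine Nat.sSup_mem hne ⟨Fintype.card V, ?_⟩
  rintro n ⟨t, -, rfl⟩
  exact Finset.card_le_univ t

theorem indepNum_induce_compl_add_card_le (G : SimpleGraph V) (S : Set V) (J : Finset V)
    (hJS : ∀ x ∈ J, x ∈ S) (hJ : IsIndepSet G J) (hout : ∀ x ∈ J, ∀ y ∉ S, ¬ G.Adj x y) :
    indepNum (G.induce Sᶜ) + J.card ≤ indepNum G := by
  classical
  obtain ⟨I, hI, hcard⟩ := exists_isIndepSet_card_eq (G.induce Sᶜ)
  have hdisj : Disjoint (I.map (Function.Embedding.subtype _)) J := by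
    rw [Finset.disjoint_left]
    intro x hx hxJ
    obtain ⟨y, -, rfl⟩ := Finset.mem_map.1 hx
    exact y.2 (hJS _ hxJ)
  rw [← hcard, ← Finset.card_map (Function.Embedding.subtype _),
    ← Finset.card_union_of_disjoint hdisj]
  refine IsIndepSet.card_le_indepNum ?_
  intro x hx y hy hxy
  rcases Finset.mem_union.1 hx with hx | hx <;> rcases Finset.mem_union.1 hy with hy | hy
  · obtain ⟨x, hxI, rfl⟩ := Finset.mem_map.1 hx
    obtain ⟨y, hyI, rfl⟩ := Finset.mem_map.1 hy
    exact hI x hxI y hyI hxy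
  · obtain ⟨x, hx, rfl⟩ := Finset.mem_map.1 hx
    exact hout y hy x x.2 hxy.symm
  · obtain ⟨y, hy, rfl⟩ := Finset.mem_map.1 hy
    exact hout x hx y y.2 hxy
  · exact hJ x hx y hy hxy

end IndependentSets

section Induce

variable {V : Type}

theorem not_hasTriangleAdjC4_induce {G : SimpleGraph V} (h : ¬ HasTriangleAdjC4 G) (T : Set V) :
    ¬ HasTriangleAdjC4 (G.induce T) := by
  rintro ⟨u, v, w, x, y, h1, h2, h3, h4, h5, h6, h7, h8⟩
  exact h ⟨u, v, w, x, y, h1, h2, h3, h4, h5, h6, fun h => h7 (Subtype.ext h),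
    fun h => h8 (Subtype.ext h)⟩

theorem numEdges_induce_compl_add_ncard_le [Fintype V] (G : SimpleGraph V) (S : Set V)
    (F : Set (Sym2 V)) (hF : F ⊆ G.edgeSet) (hFS : ∀ e ∈ F, ∃ x ∈ S, x ∈ e) :
    numEdges (G.induce Sᶜ) + F.ncard ≤ numEdges G := by
  have hinj : Function.Injective (Sym2.map (Subtype.val : (Sᶜ : Set V) → V)) :=
    Sym2.map.injective Subtype.val_injective
  change (G.induce Sᶜ).edgeSet.ncard + F.ncard ≤ G.edgeSet.ncard
  rw [← Set.ncard_image_of_injective _ hinj, ← Set.ncard_union_eq]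
  · refine Set.ncard_le_ncard (Set.union_subset ?_ hF)
    rintro _ ⟨e, he, rfl⟩
    induction e with
    | _ x y => exact he
  · rw [Set.disjoint_left]
    rintro _ ⟨e, he, rfl⟩ heF
    obtain ⟨x, hx, hxe⟩ := hFS _ heF
    obtain ⟨y, -, rfl⟩ := Sym2.mem_map.1 hxe
    exact y.2 hx

end Induce

section DifficultSets

variable {V W : Type}

theorem chainGraph_preconnected : chainGraph.Preconnected := by
  have h : ∀ i, chainGraph.Reachable i 2 := by
    have h32 : chainGraph.Reachable 3 2 := Adj.reachable (by simp [chainGraph])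
    intro i
    fin_cases i
    · exact Adj.reachable (by simp [chainGraph])
    · exact Adj.reachable (by simp [chainGraph])
    · exact Reachable.refl _
    · exact h32
    · exact (Adj.reachable (by simp [chainGraph])).trans h32
    · exact (Adj.reachable (by simp [chainGraph])).trans h32
  exact fun i j => (h i).trans (h j).symm

theorem mem_of_reachable {G : SimpleGraph V} {Q : Set V}
    (hQ : ∀ x ∈ Q, ∀ y, G.Adj x y → y ∈ Q) {x y : V} (h : G.Reachable x y) (hx : x ∈ Q) :
    y ∈ Q := by
  obtain ⟨p⟩ := h
  induction p with
  | nil => exact hx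
  | cons hadj _ ih => exact ih (hQ _ hx _ hadj)

theorem IsDifficultSet.subset {G : SimpleGraph V} {D Q : Set V} (hD : IsDifficultSet G D)
    (hQ : ∀ x ∈ D, ∀ y ∈ D, x ∈ Q → G.Adj x y → y ∈ Q) {x : V} (hxD : x ∈ D) (hxQ : x ∈ Q) :
    D ⊆ Q := by
  have key : ∀ {U : Type} {K : SimpleGraph U} (f : K ↪g G), K.Preconnected → Set.range f = D →
      D ⊆ Q := by
    rintro U K f hK rfl
    obtain ⟨i, rfl⟩ := hxD
    rintro _ ⟨j, rfl⟩
    refine mem_of_reachable (G := K) (Q := f ⁻¹' Q) ?_ (hK i j) hxQ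
    exact fun k hk l hkl => hQ _ ⟨k, rfl⟩ _ ⟨l, rfl⟩ hk (f.map_adj_iff.2 hkl)
  rcases hD with ⟨f, hf⟩ | ⟨f, hf⟩
  · exact key f (connected_top.preconnected) hf
  · exact key f chainGraph_preconnected hf

theorem IsDifficultSet.nonempty {G : SimpleGraph V} {D : Set V} (hD : IsDifficultSet G D) :
    D.Nonempty := by
  rcases hD with ⟨f, rfl⟩ | ⟨f, rfl⟩ <;> exact Set.range_nonempty _

theorem difficultSets_eq_of_mem {G : SimpleGraph V} {T D E : Set V} (hD : D ∈ difficultSets G T)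
    (hE : E ∈ difficultSets G T) {x : V} (hxD : x ∈ D) (hxE : x ∈ E) : D = E := by
  refine Set.Subset.antisymm ?_ ?_
  · exact hD.1.subset (fun x _ y hy hxE h => hE.2.2 x hxE y (hD.2.1 hy) h) hxD hxE
  · exact hE.1.subset (fun x _ y hy hxD h => hD.2.2 x hxD y (hE.2.1 hy) h) hxE hxD

theorem nonempty_induce_iso_iff {U : Type} (K : SimpleGraph U) (H : SimpleGraph W)
    (G : SimpleGraph V) (φ : H ↪g G) (D : Set W) :
    Nonempty (H.induce D ≃g K) ↔ ∃ f : K ↪g G, Set.range f = φ '' D := by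
  constructor
  · rintro ⟨e⟩
    refine ⟨(φ.comp (Embedding.induce D)).comp e.symm.toEmbedding, ?_⟩
    ext x
    constructor
    · rintro ⟨i, rfl⟩
      exact ⟨(e.symm i).1, (e.symm i).2, rfl⟩
    · rintro ⟨y, hy, rfl⟩
      exact ⟨e ⟨y, hy⟩, by simp⟩
  · rintro ⟨f, hf⟩
    have hmem : ∀ i, ∃ y : D, φ y = f i := by
      intro i
      obtain ⟨y, hy, h⟩ := hf ▸ Set.mem_range_self (f := f) i
      exact ⟨⟨y, hy⟩, h⟩
    choose g hg using hmem
    have hbij : Function.Bijective g := by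
      constructor
      · intro i j hij
        exact f.injective (by rw [← hg i, ← hg j, hij])
      · rintro ⟨y, hy⟩
        obtain ⟨i, hi⟩ : φ y ∈ Set.range f := hf ▸ ⟨y, hy, rfl⟩
        exact ⟨i, Subtype.ext (φ.injective ((hg i).trans hi))⟩
    refine ⟨RelIso.symm ⟨Equiv.ofBijective g hbij, ?_⟩⟩
    intro i j
    change H.Adj (g i) (g j) ↔ K.Adj i j
    rw [← φ.map_adj_iff, hg, hg, f.map_adj_iff]

theorem isDifficult_iff (H : SimpleGraph W) (G : SimpleGraph V) (φ : H ↪g G)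
    (c : H.ConnectedComponent) : IsDifficult H c ↔ IsDifficultSet G (φ '' c.supp) :=
  or_congr (nonempty_induce_iso_iff _ H G φ _) (nonempty_induce_iso_iff _ H G φ _)

theorem lambda_eq_ncard_difficultSets (H : SimpleGraph W) (G : SimpleGraph V) (φ : H ↪g G) :
    lambda H = (difficultSets G (Set.range φ)).ncard := by
  change {c : H.ConnectedComponent | IsDifficult H c}.ncard = _
  refine Set.ncard_congr (fun c _ => φ '' c.supp) ?_ ?_ ?_
  · intro c hc
    refine ⟨(isDifficult_iff H G φ c).1 hc, Set.image_subset_range _ _, ?_⟩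
    rintro _ ⟨x, hx, rfl⟩ _ ⟨y, rfl⟩ hxy
    exact ⟨y, (c.mem_supp_congr_adj (φ.map_adj_iff.1 hxy)).1 hx, rfl⟩
  · intro c d _ _ h
    exact ConnectedComponent.supp_injective (φ.injective.image_injective h)
  · rintro D ⟨hD, hsub, hcl⟩
    obtain ⟨z, hz⟩ := hD.nonempty
    obtain ⟨x, rfl⟩ := hsub hz
    have heq : φ '' (H.connectedComponentMk x).supp = D := by
      refine Set.Subset.antisymm ?_ ?_
      · rintro _ ⟨y, hy, rfl⟩
        refine mem_of_reachable (G := H) (Q := φ ⁻¹' D) ?_ (ConnectedComponent.exact hy).symm hz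
        exact fun u hu v huv => hcl _ hu _ ⟨v, rfl⟩ (φ.map_adj_iff.2 huv)
      · refine hD.subset ?_ hz ⟨x, rfl, rfl⟩
        rintro _ _ _ hv ⟨u, hu, rfl⟩ huv
        obtain ⟨v, rfl⟩ := hsub hv
        exact ⟨v, ((H.connectedComponentMk x).mem_supp_congr_adj (φ.map_adj_iff.1 huv)).1 hu, rfl⟩
    exact ⟨H.connectedComponentMk x, (isDifficult_iff H G φ _).2 (heq ▸ hD), heq⟩

theorem lambda_eq (G : SimpleGraph V) : lambda G = (difficultSets G Set.univ).ncard := by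
  rw [lambda_eq_ncard_difficultSets G G (Embedding.refl)]
  congr 2
  exact Set.range_id

theorem lambda_induce (G : SimpleGraph V) (T : Set V) :
    lambda (G.induce T) = (difficultSets G T).ncard := by
  rw [lambda_eq_ncard_difficultSets _ G (Embedding.induce T)]
  congr 2
  exact Subtype.range_coe

/-- The difficult components of `G - S` joined to `S` by an edge. -/
def touchingSets (G : SimpleGraph V) (S : Set V) : Set (Set V) :=
  {D | D ∈ difficultSets G Sᶜ ∧ ∃ x ∈ S, ∃ y ∈ D, G.Adj x y}

/-- The difficult components of `G` that meet `S`. -/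
def meetingSets (G : SimpleGraph V) (S : Set V) : Set (Set V) :=
  {D | D ∈ difficultSets G Set.univ ∧ (D ∩ S).Nonempty}

theorem lambda_induce_compl_add_le [Fintype V] (G : SimpleGraph V) (S : Set V) :
    lambda (G.induce Sᶜ) + (meetingSets G S).ncard ≤ lambda G + (touchingSets G S).ncard := by
  rw [lambda_induce, lambda_eq]
  have hsub : difficultSets G Sᶜ ⊆
      (difficultSets G Set.univ \ meetingSets G S) ∪ touchingSets G S := by
    intro D hD
    by_cases ht : D ∈ touchingSets G S
    · exact Or.inr ht
    · refine Or.inl ⟨⟨hD.1, Set.subset_univ _, ?_⟩, ?_⟩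
      · intro x hx y _ hxy
        by_cases hy : y ∈ S
        · exact absurd ⟨hD, y, hy, x, hx, hxy.symm⟩ ht
        · exact hD.2.2 x hx y hy hxy
      · rintro ⟨-, x, hxD, hxS⟩
        exact hD.2.1 hxD hxS
  have hM : meetingSets G S ⊆ difficultSets G Set.univ := fun D hD => hD.1
  have h1 := (Set.ncard_le_ncard hsub).trans (Set.ncard_union_le _ _)
  have h2 := Set.ncard_sdiff_add_ncard_of_subset hM
  omega

theorem ncard_touchingSets_le [Fintype V] (G : SimpleGraph V) (S : Set V) :
    (touchingSets G S).ncard ≤ (boundary G S).ncard := by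
  have hex : ∀ D : touchingSets G S, ∃ e : boundary G S,
      ∃ x ∈ S, ∃ y ∈ D.1, (e : Sym2 V) = s(x, y) := by
    rintro ⟨D, hD, x, hx, y, hy, hxy⟩
    exact ⟨⟨s(x, y), mem_boundary hxy hx (hD.2.1 hy)⟩, x, hx, y, hy, rfl⟩
  choose f hf using hex
  refine Nat.card_le_card_of_injective f ?_
  intro D E h
  obtain ⟨x, hx, y, hy, hxy⟩ := hf D
  obtain ⟨x', hx', y', hy', hxy'⟩ := hf E
  rw [h, hxy', Sym2.eq_iff] at hxy
  refine Subtype.ext ?_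
  rcases hxy with ⟨-, rfl⟩ | ⟨rfl, -⟩
  · exact difficultSets_eq_of_mem D.2.1 E.2.1 hy hy'
  · exact absurd hx' (D.2.1.2.1 hy)

end DifficultSets

section Triangles

variable {V : Type} {G : SimpleGraph V}

/-- The vertices `u`, `v`, `w` form a triangle. -/
def IsTriangle (G : SimpleGraph V) (u v w : V) : Prop :=
  G.Adj u v ∧ G.Adj v w ∧ G.Adj w u

theorem IsTriangle.exists_rotation {u v w x : V} (h : IsTriangle G u v w)
    (hx : x ∈ ({u, v, w} : Set V)) :
    ∃ p q, IsTriangle G p q x ∧ ({p, q, x} : Set V) = {u, v, w} := by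
  obtain ⟨h1, h2, h3⟩ := h
  rcases hx with rfl | rfl | rfl
  · exact ⟨v, w, ⟨h2, h3, h1⟩, by grind⟩
  · exact ⟨w, u, ⟨h3, h1, h2⟩, by grind⟩
  · exact ⟨u, v, ⟨h1, h2, h3⟩, rfl⟩

theorem IsTriangle.ncard_eq {u v w : V} (h : IsTriangle G u v w) :
    ({u, v, w} : Set V).ncard = 3 :=
  Set.ncard_eq_three.2 ⟨u, v, w, h.1.ne, h.2.2.ne', h.2.1.ne, rfl⟩

theorem exists_embedding_range_eq {U : Type} (K : SimpleGraph U) (g : U → V)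
    (hinj : Function.Injective g) (hadj : ∀ i j, G.Adj (g i) (g j) ↔ K.Adj i j) :
    ∃ f : K ↪g G, Set.range f = Set.range g :=
  ⟨⟨⟨g, hinj⟩, hadj _ _⟩, rfl⟩

theorem range_fin_three (f : Fin 3 → V) : Set.range f = {f 0, f 1, f 2} := by
  ext x
  simp [Fin.exists_fin_succ, eq_comm]

theorem IsTriangle.isDifficultSet {u v w : V} (h : IsTriangle G u v w) :
    IsDifficultSet G {u, v, w} := by
  obtain ⟨h1, h2, h3⟩ := h
  have hrange : ({u, v, w} : Set V) = Set.range ![u, v, w] := (range_fin_three ![u, v, w]).symm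
  rw [hrange]
  refine Or.inl (exists_embedding_range_eq _ _ ?_ ?_)
  · intro i j
    fin_cases i <;> fin_cases j <;>
      simp [h1.ne, h1.ne', h2.ne, h2.ne', h3.ne, h3.ne']
  · intro i j
    fin_cases i <;> fin_cases j <;>
      simp [h1, h1.symm, h2, h2.symm, h3, h3.symm]

theorem isTriangle_of_embedding (f : (⊤ : SimpleGraph (Fin 3)) ↪g G) :
    IsTriangle G (f 0) (f 1) (f 2) :=
  ⟨f.map_adj_iff.2 (by simp), f.map_adj_iff.2 (by simp), f.map_adj_iff.2 (by simp)⟩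

theorem isDifficultSet_of_joined_triangles {u v w x y z : V} (h : IsTriangle G u v w)
    (h' : IsTriangle G y z x) (hdisj : ∀ p ∈ ({y, z, x} : Set V), p ∉ ({u, v, w} : Set V))
    (hwx : G.Adj w x)
    (honly : ∀ p ∈ ({u, v, w} : Set V), ∀ q ∉ ({u, v, w} : Set V), G.Adj p q → p = w ∧ q = x) :
    IsDifficultSet G ({u, v, w} ∪ {y, z, x}) := by
  have hne : ∀ p ∈ ({u, v, w} : Set V), ∀ q ∈ ({y, z, x} : Set V), p ≠ q := by
    rintro p hp q hq rfl
    exact hdisj p hq hp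
  have hnot : ∀ p ∈ ({u, v, w} : Set V), ∀ q ∈ ({y, z, x} : Set V), ¬ (p = w ∧ q = x) →
      ¬ G.Adj p q := fun p hp q hq hpq had => hpq (honly p hp q (hdisj q hq) had)
  obtain ⟨h1, h2, h3⟩ := h
  obtain ⟨h4, h5, h6⟩ := h'
  simp only [Set.mem_insert_iff, Set.mem_singleton_iff, forall_eq_or_imp, forall_eq] at hne hnot
  obtain ⟨⟨n1, n2, n3⟩, ⟨n4, n5, n6⟩, n7, n8, n9⟩ := hne
  simp only [h2.ne, h3.ne', h5.ne, h6.ne', false_and, and_false, not_false_eq_true,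
    true_implies] at hnot
  obtain ⟨⟨m1, m2, m3⟩, ⟨m4, m5, m6⟩, m7, m8, -⟩ := hnot
  have hrange : ({u, v, w} ∪ {y, z, x} : Set V) = Set.range ![u, v, w, x, y, z] := by
    ext t
    simp
    grind
  rw [hrange]
  refine Or.inr (exists_embedding_range_eq _ _ ?_ ?_)
  · intro i j
    fin_cases i <;> fin_cases j <;>
      simp [h1.ne, h1.ne', h2.ne, h2.ne', h3.ne, h3.ne', h4.ne, h4.ne', h5.ne, h5.ne', h6.ne,
        h6.ne', n1, n2, n3, n4, n5, n6, n7, n8, n9, n1.symm, n2.symm, n3.symm, n4.symm, n5.symm,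
        n6.symm, n7.symm, n8.symm, n9.symm]
  · intro i j
    fin_cases i <;> fin_cases j <;>
      simp [chainGraph, h1, h1.symm, h2, h2.symm, h3, h3.symm, h4, h4.symm, h5, h5.symm, h6,
        h6.symm, hwx, hwx.symm, m1, m2, m3, m4, m5, m6, m7, m8, mt Adj.symm m1, mt Adj.symm m2,
        mt Adj.symm m3, mt Adj.symm m4, mt Adj.symm m5, mt Adj.symm m6, mt Adj.symm m7,
        mt Adj.symm m8]

theorem IsTriangle.exists_not_adj_outside [Fintype V] {u v w : V} (h : IsTriangle G u v w)
    (hphi : (boundary G {u, v, w}).ncard ≤ 2) :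
    ∃ z ∈ ({u, v, w} : Set V), ∀ y ∉ ({u, v, w} : Set V), ¬ G.Adj z y := by
  by_contra! hcon
  obtain ⟨x, hx, hux⟩ := hcon u (by simp)
  obtain ⟨y, hy, hvy⟩ := hcon v (by simp)
  obtain ⟨z, hz, hwz⟩ := hcon w (by simp)
  have hsub : {s(u, x), s(v, y), s(w, z)} ⊆ boundary G {u, v, w} := by
    rintro e (rfl | rfl | rfl)
    · exact mem_boundary hux (by simp) hx
    · exact mem_boundary hvy (by simp) hy
    · exact mem_boundary hwz (by simp) hz
  have h1 := h.1.ne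
  have h2 := h.2.1.ne
  have h3 := h.2.2.ne
  have hcard : ({s(u, x), s(v, y), s(w, z)} : Set (Sym2 V)).ncard = 3 := by
    simp only [Set.mem_insert_iff, Set.mem_singleton_iff, not_or] at hx hy hz
    refine Set.ncard_eq_three.2 ⟨_, _, _, ?_, ?_, ?_, rfl⟩ <;> rw [Ne, Sym2.eq_iff] <;> grind
  have := Set.ncard_le_ncard hsub
  omega

/-- The edges of the triangle `u v w` together with the edges leaving it. -/
def incidentEdges (G : SimpleGraph V) (u v w : V) : Set (Sym2 V) :=
  {s(u, v), s(v, w), s(w, u)} ∪ boundary G {u, v, w}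

theorem IsTriangle.incidentEdges_subset {u v w : V} (h : IsTriangle G u v w) :
    incidentEdges G u v w ⊆ G.edgeSet := by
  rintro e ((rfl | rfl | rfl) | he)
  · exact h.1
  · exact h.2.1
  · exact h.2.2
  · exact he.1

theorem exists_mem_of_mem_incidentEdges {u v w : V} {e : Sym2 V}
    (he : e ∈ incidentEdges G u v w) : ∃ x ∈ ({u, v, w} : Set V), x ∈ e := by
  rcases he with (rfl | rfl | rfl) | ⟨-, x, hx, y, -, rfl⟩
  · exact ⟨u, by simp, by simp⟩
  · exact ⟨v, by simp, by simp⟩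
  · exact ⟨w, by simp, by simp⟩
  · exact ⟨x, hx, by simp⟩

theorem IsTriangle.ncard_incidentEdges [Fintype V] {u v w : V} (h : IsTriangle G u v w) :
    (incidentEdges G u v w).ncard = 3 + (boundary G {u, v, w}).ncard := by
  have h1 := h.1.ne
  have h2 := h.2.1.ne
  have h3 := h.2.2.ne
  rw [incidentEdges, Set.ncard_union_eq]
  · congr 1
    refine Set.ncard_eq_three.2 ⟨_, _, _, ?_, ?_, ?_, rfl⟩ <;> rw [Ne, Sym2.eq_iff] <;> grind
  · rw [Set.disjoint_left]
    rintro e he ⟨-, x, -, y, hy, rfl⟩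
    simp only [Set.mem_insert_iff, Set.mem_singleton_iff, Sym2.eq_iff] at he hy
    grind

theorem exists_isTriangle_ncard_boundary_le_one_of_chain [Fintype V] (f : chainGraph ↪g G)
    {i : Fin 6} {x₀ : V}
    (honly : ∀ x ∈ Set.range f, ∀ y ∉ Set.range f, G.Adj x y → x = f i ∧ y = x₀)
    (p q r : Fin 6) (hpqr : IsTriangle chainGraph p q r) (hi : i ≠ p ∧ i ≠ q ∧ i ≠ r)
    (hbd : ∀ k l, (k = p ∨ k = q ∨ k = r) → ¬ (l = p ∨ l = q ∨ l = r) → chainGraph.Adj k l →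
      s(k, l) = s(2, 3)) :
    ∃ u v w, IsTriangle G u v w ∧ (boundary G {u, v, w}).ncard ≤ 1 := by
  refine ⟨f p, f q, f r, ⟨f.map_adj_iff.2 hpqr.1, f.map_adj_iff.2 hpqr.2.1,
    f.map_adj_iff.2 hpqr.2.2⟩, ?_⟩
  rw [← Set.ncard_singleton (s(f 2, f 3))]
  refine Set.ncard_le_ncard ?_
  rintro _ ⟨hadj, x, hx, y, hy, rfl⟩
  have hk : ∃ k, (k = p ∨ k = q ∨ k = r) ∧ f k = x := by
    rcases hx with rfl | rfl | rfl <;> simp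
  obtain ⟨k, hk, rfl⟩ := hk
  by_cases hyf : y ∈ Set.range f
  · obtain ⟨l, rfl⟩ := hyf
    have hl : ¬ (l = p ∨ l = q ∨ l = r) := by
      rintro (rfl | rfl | rfl) <;> simp at hy
    have := congrArg (Sym2.map f) (hbd k l hk hl (f.map_adj_iff.1 hadj))
    simpa using this
  · have := f.injective (honly _ ⟨k, rfl⟩ y hyf hadj).1
    grind

theorem IsDifficultSet.exists_isTriangle_ncard_boundary_le_one [Fintype V] {D : Set V}
    (hD : IsDifficultSet G D) {x₀ y₀ : V} (hy₀ : y₀ ∈ D)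
    (honly : ∀ x ∈ D, ∀ y ∉ D, G.Adj x y → x = y₀ ∧ y = x₀) :
    ∃ u v w, IsTriangle G u v w ∧ (boundary G {u, v, w}).ncard ≤ 1 := by
  rcases hD with ⟨f, rfl⟩ | ⟨f, rfl⟩
  · refine ⟨_, _, _, isTriangle_of_embedding f, ?_⟩
    rw [← range_fin_three f, ← Set.ncard_singleton (s(y₀, x₀))]
    refine Set.ncard_le_ncard ?_
    rintro _ ⟨hadj, x, hx, y, hy, rfl⟩
    obtain ⟨rfl, rfl⟩ := honly x hx y hy hadj
    rfl
  · obtain ⟨i, rfl⟩ := hy₀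
    by_cases hi : i = 0 ∨ i = 1 ∨ i = 2
    · refine exists_isTriangle_ncard_boundary_le_one_of_chain f honly 3 4 5 ?_ ?_ ?_
      · simp [IsTriangle, chainGraph]
      · grind
      · simp only [chainGraph, SimpleGraph.fromRel_adj]
        decide
    · refine exists_isTriangle_ncard_boundary_le_one_of_chain f honly 0 1 2 ?_ ?_ ?_
      · simp [IsTriangle, chainGraph]
      · grind
      · simp only [chainGraph, SimpleGraph.fromRel_adj]
        decide

/-- The seven edges of the 2-chain of triangles. -/
def chainEdges : Finset (Sym2 (Fin 6)) :=
  {s(0, 1), s(0, 2), s(1, 2), s(3, 4), s(3, 5), s(4, 5), s(2, 3)}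

theorem chainEdges_subset : (chainEdges : Set (Sym2 (Fin 6))) ⊆ chainGraph.edgeSet := by
  intro e he
  simp only [chainEdges, Finset.coe_insert, Finset.coe_singleton, Set.mem_insert_iff,
    Set.mem_singleton_iff] at he
  rcases he with rfl | rfl | rfl | rfl | rfl | rfl | rfl <;> simp [chainGraph]

theorem card_chainEdges : chainEdges.card = 7 := by decide

end Triangles

section MinimumCounterexample

variable {V : Type} [Fintype V] {G : SimpleGraph V} {a b : ℝ}

/-- `G` is a counterexample to the bound with the fewest vertices. -/
structure IsMinCounterexample (a b : ℝ) {V : Type} (G : SimpleGraph V) : Prop where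
  not_hasTriangleAdjC4 : ¬ HasTriangleAdjC4 G
  not_hasBound : ¬ HasBound a b G
  hasBound_of_card_lt : ∀ (W : Type) [Fintype W] (G' : SimpleGraph W),
    Nat.card W < Nat.card V → ¬ HasTriangleAdjC4 G' → HasBound a b G'

theorem IsMinCounterexample.cost_lt (h : IsMinCounterexample a b G) (hb : 0 < b) (S : Set V)
    (hS : S.Nonempty) (J : Finset V) (hJS : ∀ x ∈ J, x ∈ S) (hJ : IsIndepSet G J)
    (hout : ∀ x ∈ J, ∀ y ∉ S, ¬ G.Adj x y) (F : Set (Sym2 V)) (hF : F ⊆ G.edgeSet)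
    (hFS : ∀ e ∈ F, ∃ x ∈ S, x ∈ e) :
    a * S.ncard + b * F.ncard + b * (meetingSets G S).ncard + J.card <
      S.ncard + b * (touchingSets G S).ncard := by
  classical
  have hcard : S.ncard + Nat.card (Sᶜ : Set V) = Nat.card V := S.ncard_add_ncard_compl
  have hpos : 0 < S.ncard := (Set.ncard_pos).2 hS
  have hmin := h.hasBound_of_card_lt (Sᶜ : Set V) (G.induce Sᶜ) (by omega)
    (not_hasTriangleAdjC4_induce h.not_hasTriangleAdjC4 _)
  have hnot := h.not_hasBound
  unfold HasBound at hmin hnot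
  have hα : (indepNum (G.induce Sᶜ) : ℝ) + J.card ≤ indepNum G := by
    exact_mod_cast indepNum_induce_compl_add_card_le G S J hJS hJ hout
  have hE : (numEdges (G.induce Sᶜ) : ℝ) + F.ncard ≤ numEdges G := by
    exact_mod_cast numEdges_induce_compl_add_ncard_le G S F hF hFS
  have hl : (lambda (G.induce Sᶜ) : ℝ) + (meetingSets G S).ncard ≤
      lambda G + (touchingSets G S).ncard := by
    exact_mod_cast lambda_induce_compl_add_le G S
  have hc : (S.ncard : ℝ) + Nat.card (Sᶜ : Set V) = Nat.card V := by exact_mod_cast hcard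
  rw [← hc] at hnot
  have hE' := mul_le_mul_of_nonneg_left hE hb.le
  have hl' := mul_le_mul_of_nonneg_left hl hb.le
  push Not at hnot
  linarith

theorem IsMinCounterexample.ncard_boundary_add_le (h : IsMinCounterexample a b G) (hb : 0 < b)
    (h2 : 3 * a + 4 * b ≥ 2) {u v w : V} (ht : IsTriangle G u v w)
    (hphi : (boundary G {u, v, w}).ncard ≤ 2) :
    (boundary G {u, v, w}).ncard + (meetingSets G {u, v, w}).ncard ≤
      (touchingSets G {u, v, w}).ncard := by
  obtain ⟨z, hz, hzout⟩ := ht.exists_not_adj_outside hphi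
  have key := h.cost_lt hb {u, v, w} ⟨u, by simp⟩ {z} (by simpa using hz)
    (by simp [IsIndepSet]) (by simpa using hzout) _ ht.incidentEdges_subset
    (fun e he => exists_mem_of_mem_incidentEdges he)
  rw [ht.ncard_eq, ht.ncard_incidentEdges] at key
  by_contra! hlt
  have hlt' : ((touchingSets G {u, v, w}).ncard : ℝ) + 1 ≤
      (boundary G {u, v, w}).ncard + (meetingSets G {u, v, w}).ncard := by exact_mod_cast hlt
  have := mul_le_mul_of_nonneg_left hlt' hb.le
  push_cast at key
  simp only [Finset.card_singleton, Nat.cast_one] at key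
  linarith

theorem IsMinCounterexample.not_pendant_chain (h : IsMinCounterexample a b G) (hb : 0 < b)
    (h3 : 9 * a + 11 * b ≥ 6) {u v w y : V} (ht : IsTriangle G u v w) (f : chainGraph ↪g G)
    (hdisj : ∀ p ∈ Set.range f, p ∉ ({u, v, w} : Set V))
    (hclosed : ∀ p ∈ Set.range f, ∀ q ∉ ({u, v, w} : Set V), G.Adj p q → q ∈ Set.range f)
    (hy : y ∈ Set.range f) (hphi : (boundary G {u, v, w}).ncard = 1)
    (honly : ∀ p ∈ ({u, v, w} : Set V), ∀ q ∉ ({u, v, w} : Set V), G.Adj p q →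
      p = w ∧ q = y) : False := by
  classical
  have hclosed' : ∀ p ∈ ({u, v, w} : Set V) ∪ Set.range f,
      ∀ q ∉ ({u, v, w} : Set V) ∪ Set.range f, ¬ G.Adj p q := by
    rintro p (hp | hp) q hq hpq
    · exact hq (Or.inr ((honly p hp q (fun hq' => hq (Or.inl hq')) hpq).2 ▸ hy))
    · exact hq (Or.inr (hclosed p hp q (fun hq' => hq (Or.inl hq')) hpq))
  have huw : u ≠ w := ht.2.2.ne'
  have hu : ∀ i, ¬ G.Adj u (f i) := fun i hi =>
    huw (honly u (by simp) (f i) (hdisj _ ⟨i, rfl⟩) hi).1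
  have hne : ∀ i, u ≠ f i := fun i hi => hdisj _ ⟨i, rfl⟩ (hi ▸ by simp)
  have h05 : ¬ G.Adj (f 0) (f 5) := by
    rw [f.map_adj_iff]
    simp [chainGraph]
  have hJ : ∀ x ∈ ({u, f 0, f 5} : Finset V), x ∈ ({u, v, w} : Set V) ∪ Set.range f := by
    intro x hx
    simp only [Finset.mem_insert, Finset.mem_singleton] at hx
    rcases hx with rfl | rfl | rfl <;> simp
  have hS : (({u, v, w} : Set V) ∪ Set.range f).ncard = 9 := by
    rw [Set.ncard_union_eq (Set.disjoint_left.2 fun p hp hp' => hdisj p hp' hp), ht.ncard_eq,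
      ← Set.image_univ, Set.ncard_image_of_injective _ f.injective, Set.ncard_univ]
    simp
  have hF : (incidentEdges G u v w ∪ Sym2.map f '' (chainEdges : Set (Sym2 (Fin 6)))).ncard
      = 11 := by
    rw [Set.ncard_union_eq, ht.ncard_incidentEdges, hphi,
      Set.ncard_image_of_injective _ (Sym2.map.injective f.injective), Set.ncard_coe_finset,
      card_chainEdges]
    rw [Set.disjoint_left]
    rintro _ he ⟨e, -, rfl⟩
    obtain ⟨x, hx, hxe⟩ := exists_mem_of_mem_incidentEdges he
    obtain ⟨i, -, rfl⟩ := Sym2.mem_map.1 hxe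
    exact hdisj _ ⟨i, rfl⟩ hx
  have htouch : touchingSets G (({u, v, w} : Set V) ∪ Set.range f) = ∅ := by
    refine Set.eq_empty_of_forall_notMem ?_
    rintro D ⟨hD, p, hp, q, hq, hpq⟩
    exact hclosed' p hp q (hD.2.1 hq) hpq
  have key := h.cost_lt hb (({u, v, w} : Set V) ∪ Set.range f) ⟨u, by simp⟩ {u, f 0, f 5} hJ
    (by simp [IsIndepSet, hu, h05, G.adj_comm (f 5), G.adj_comm (f 0) u])
    (fun x hx => hclosed' x (hJ x hx))
    (incidentEdges G u v w ∪ Sym2.map f '' (chainEdges : Set (Sym2 (Fin 6)))) ?_ ?_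
  · have hJcard : ({u, f 0, f 5} : Finset V).card = 3 :=
      Finset.card_eq_three.2 ⟨_, _, _, hne 0, hne 5, f.injective.ne (by decide), rfl⟩
    rw [hS, hF, htouch, hJcard, Set.ncard_empty] at key
    have : 0 ≤ b * ((meetingSets G (({u, v, w} : Set V) ∪ Set.range f)).ncard : ℝ) := by
      positivity
    push_cast at key
    linarith
  · refine Set.union_subset ht.incidentEdges_subset ?_
    rintro _ ⟨e, he, rfl⟩
    have hadj := chainEdges_subset he
    induction e with
    | _ i j => exact f.map_adj_iff.2 hadj
  · rintro e (he | ⟨e, -, rfl⟩)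
    · obtain ⟨x, hx, hxe⟩ := exists_mem_of_mem_incidentEdges he
      exact ⟨x, Or.inl hx, hxe⟩
    · induction e with
      | _ i j => exact ⟨f i, Or.inr ⟨i, rfl⟩, by simp⟩

theorem IsMinCounterexample.two_le_ncard_boundary (h : IsMinCounterexample a b G) (hb : 0 < b)
    (h2 : 3 * a + 4 * b ≥ 2) (h3 : 9 * a + 11 * b ≥ 6) {u v w : V} (ht : IsTriangle G u v w) :
    2 ≤ (boundary G {u, v, w}).ncard := by
  by_contra! hlt
  have hkey := h.ncard_boundary_add_le hb h2 ht (by omega)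
  have hle := ncard_touchingSets_le G {u, v, w}
  have hmeet : meetingSets G {u, v, w} = ∅ := (Set.ncard_eq_zero).1 (by omega)
  obtain h0 | h1 : (boundary G {u, v, w}).ncard = 0 ∨ (boundary G {u, v, w}).ncard = 1 := by
    omega
  · have hbd : boundary G {u, v, w} = ∅ := (Set.ncard_eq_zero).1 h0
    have hmem : ({u, v, w} : Set V) ∈ meetingSets G {u, v, w} := by
      refine ⟨⟨ht.isDifficultSet, Set.subset_univ _, ?_⟩, u, by simp⟩
      intro x hx y _ hxy
      by_contra hy
      exact (hbd ▸ mem_boundary hxy hx hy : s(x, y) ∈ (∅ : Set (Sym2 V)))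
    simp [hmeet] at hmem
  · obtain ⟨D, hD, x, hx, y, hy, hxy⟩ : (touchingSets G {u, v, w}).Nonempty :=
      (Set.ncard_pos).1 (by omega)
    obtain ⟨p, q, ht', hset⟩ := ht.exists_rotation hx
    rw [← hset] at h1 hD hmeet
    have hyout : y ∉ ({p, q, x} : Set V) := hD.2.1 hy
    obtain ⟨e, he⟩ := Set.ncard_eq_one.1 h1
    have hexy : s(x, y) = e := by
      have := mem_boundary hxy (S := {p, q, x}) (by simp) hyout
      rwa [he] at this
    have honly : ∀ s ∈ ({p, q, x} : Set V), ∀ t ∉ ({p, q, x} : Set V), G.Adj s t →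
        s = x ∧ t = y := by
      intro s hs t ht hst
      have hmem := mem_boundary hst hs ht
      rw [he, ← hexy, Set.mem_singleton_iff, Sym2.eq_iff] at hmem
      rcases hmem with hmem | ⟨rfl, -⟩
      · exact hmem
      · exact absurd hs hyout
    rcases hD.1 with ⟨f, rfl⟩ | ⟨f, rfl⟩
    · have htf := isTriangle_of_embedding f
      have hrange := range_fin_three f
      rw [hrange] at hy
      obtain ⟨r, s, ht'', hset'⟩ := htf.exists_rotation hy
      rw [hrange, ← hset'] at hD
      have hmem : ({p, q, x} ∪ {r, s, y} : Set V) ∈ meetingSets G {p, q, x} := by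
        refine ⟨⟨isDifficultSet_of_joined_triangles ht' ht'' hD.2.1 hxy honly,
          Set.subset_univ _, ?_⟩, x, by simp⟩
        intro c hc d _ hcd
        by_cases hd : d ∈ ({p, q, x} : Set V)
        · exact Or.inl hd
        · rcases hc with hc | hc
          · rw [(honly c hc d hd hcd).2]
            simp
          · exact Or.inr (hD.2.2 c hc d hd hcd)
      rw [hmeet] at hmem
      exact hmem
    · exact h.not_pendant_chain hb h3 ht' f hD.2.1 hD.2.2 hy h1 honly

theorem IsMinCounterexample.three_le_ncard_boundary (h : IsMinCounterexample a b G) (hb : 0 < b)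
    (h2 : 3 * a + 4 * b ≥ 2) (h3 : 9 * a + 11 * b ≥ 6) {u v w : V} (ht : IsTriangle G u v w) :
    3 ≤ (boundary G {u, v, w}).ncard := by
  by_contra! hlt
  have hge := h.two_le_ncard_boundary hb h2 h3 ht
  have hkey := h.ncard_boundary_add_le hb h2 ht (by omega)
  obtain ⟨D, hD, E, hE, hDE⟩ := (Set.one_lt_ncard).1
    (show 1 < (touchingSets G {u, v, w}).ncard by omega)
  obtain ⟨hD, x, hx, y, hy, hxy⟩ := hD
  obtain ⟨hE, x', hx', y', hy', hxy'⟩ := hE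
  have hdisj : ∀ z ∈ D, z ∉ E := fun z hzD hzE => hDE (difficultSets_eq_of_mem hD hE hzD hzE)
  have hne : s(x, y) ≠ s(x', y') := by
    rw [Ne, Sym2.eq_iff]
    rintro (⟨-, rfl⟩ | ⟨rfl, -⟩)
    · exact hdisj y hy hy'
    · exact hE.2.1 hy' hx
  have hbd : boundary G {u, v, w} = {s(x, y), s(x', y')} := by
    refine (Set.eq_of_subset_of_ncard_le ?_ ?_).symm
    · rintro e (rfl | rfl)
      · exact mem_boundary hxy hx (hD.2.1 hy)
      · exact mem_boundary hxy' hx' (hE.2.1 hy')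
    · rw [Set.ncard_pair hne]
      omega
  obtain ⟨p, q, r, hpqr, hle⟩ := hD.1.exists_isTriangle_ncard_boundary_le_one (x₀ := x) hy (by
    intro s hs t ht hst
    have htS : t ∈ ({u, v, w} : Set V) := by
      by_contra htS
      exact ht (hD.2.2 s hs t htS hst)
    have hmem := mem_boundary hst.symm htS (hD.2.1 hs)
    rw [hbd, Set.mem_insert_iff, Set.mem_singleton_iff, Sym2.eq_iff, Sym2.eq_iff] at hmem
    rcases hmem with (⟨rfl, rfl⟩ | ⟨rfl, -⟩) | ⟨-, rfl⟩ | ⟨rfl, -⟩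
    · exact ⟨rfl, rfl⟩
    · exact absurd htS (hD.2.1 hy)
    · exact absurd hy' (hdisj _ hs)
    · exact absurd htS (hE.2.1 hy'))
  have := h.two_le_ncard_boundary hb h2 h3 hpqr
  omega

end MinimumCounterexample

/-- Claim 2.6: every triangle H of a minimum counterexample satisfies Φ(H) ≥ 3. -/
theorem claim_triangle_edges_leaving
(a b : ℝ) (ha : 0 < a) (hb : 0 < b)
    (h1 : 2 * a + b ≥ 1) (h2 : 3 * a + 4 * b ≥ 2) (h3 : 9 * a + 11 * b ≥ 6)
    (h4 : a + 5 * b ≥ 1) (h5 : 4 * a + 9 * b ≥ 3) (h6 : 10 * a + 16 * b ≥ 7)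
    (h7 : 13 * a + 20 * b ≥ 8) (h8 : 5 * a + 14 * b ≥ 4)
    (h9 : a + (3 / 2) * b ≥ 2 / 3)
{V : Type} [Fintype V] (G : SimpleGraph V)
    (hG : ¬ HasTriangleAdjC4 G)
    (hcex : (indepNum G : ℝ) <
      (Nat.card V : ℝ) - (a * Nat.card V + b * numEdges G + b * lambda G))
    (hmin : ∀ (W : Type) [Fintype W] (G' : SimpleGraph W),
      Nat.card W < Nat.card V → ¬ HasTriangleAdjC4 G' →
      (indepNum G' : ℝ) ≥
        (Nat.card W : ℝ) - (a * Nat.card W + b * numEdges G' + b * lambda G')) :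
    ∀ u v w : V, G.Adj u v → G.Adj v w → G.Adj w u →
      3 ≤ phi G {u, v, w} := by
  intro u v w huv hvw hwu
  have h : IsMinCounterexample a b G := ⟨hG, not_le.2 hcex, hmin⟩
  exact h.three_le_ncard_boundary hb h2 h3 ⟨huv, hvw, hwu⟩

end Paper
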